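/- Let A ∈ ℝ^{n×d} have rank r and thin SVD A = UΣVᵀ with singular values σ₁ ≥ … ≥ σ_r > 0, let 1 ≤ k < r, set λ = ‖A_{k,⊥}‖_F²/k, and define Σ_λ = diag(σ₁/√(σ₁²+λ), …, σ_r/√(σ_r²+λ)) ∈ ℝ^{r×r}, ridge leverage scores τ_i^λ = ‖(UΣ_λ)_{i*}‖₂², d_λ = Σ_i τ_i^λ, and sampling probabilities p_i = τ_i^λ/d_λ. Let W ∈ ℝ^{s×n} be the random sampling-and-rescaling matrix of Algorithm 1 built from these probabilities, and let ε ∈ (0,1), δ ∈ (0,1). If s ≥ (1 + ε/3) · 4k ln(16(1+2k)/δ)/ε², then P(‖Σ_λ Uᵀ Wᵀ W U Σ_λ − Σ_λ²‖₂ ≥ ε) ≤ δ/4. -/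

import Mathlib

open Matrix BigOperators

noncomputable def frobNorm {m n : Type*} [Fintype m] [Fintype n]
    (A : Matrix m n ℝ) : ℝ := Real.sqrt (∑ i, ∑ j, (A i j) ^ 2)

noncomputable def specNorm {m n : ℕ} (A : Matrix (Fin m) (Fin n) ℝ) : ℝ :=
  ‖LinearMap.toContinuousLinearMap (Matrix.toEuclideanLin A)‖

noncomputable def truncDiag {r : ℕ} (σ : Fin r → ℝ) (m : ℕ) :
    Matrix (Fin r) (Fin r) ℝ :=
  Matrix.diagonal fun i => if (i : ℕ) < m then σ i else 0

noncomputable def samplingMatrix {n : ℕ} (p : Fin n → ℝ) (s : ℕ) (ω : Fin s → Fin n) :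
    Matrix (Fin s) (Fin n) ℝ :=
  fun i j => if j = ω i then 1 / Real.sqrt (s * p j) else 0

noncomputable def expec {n s : ℕ} (p : Fin n → ℝ) (f : (Fin s → Fin n) → ℝ) : ℝ :=
  ∑ ω : Fin s → Fin n, (∏ i, p (ω i)) * f ω

open Classical in
noncomputable def probOf {n s : ℕ} (p : Fin n → ℝ) (E : (Fin s → Fin n) → Prop) : ℝ :=
  ∑ ω : Fin s → Fin n, if E ω then (∏ i, p (ω i)) else 0

def firstCols {n r : ℕ} (U : Matrix (Fin n) (Fin r) ℝ) (k : ℕ) (h : k ≤ r) :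
    Matrix (Fin n) (Fin k) ℝ :=
  fun i j => U i (Fin.castLE h j)

noncomputable def ridgeDiag {r : ℕ} (σ : Fin r → ℝ) (lam : ℝ) :
    Matrix (Fin r) (Fin r) ℝ :=
  Matrix.diagonal fun i => σ i / Real.sqrt (σ i ^ 2 + lam)


namespace Matrix

variable {ι : Type*} [Fintype ι] [DecidableEq ι] {A B : Matrix ι ι ℝ}

lemma trace_diagonal_mul_mul_diagonal_mul_transpose (a b : ι → ℝ) (M N : Matrix ι ι ℝ) :
    trace (diagonal a * M * diagonal b * Nᵀ) = ∑ i, ∑ j, a i * b j * (M i j * N i j) := by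
  simp only [trace, diag_apply]
  refine Finset.sum_congr rfl fun i _ => ?_
  rw [mul_apply]
  refine Finset.sum_congr rfl fun j _ => ?_
  rw [mul_diagonal, diagonal_mul, transpose_apply]
  ring

namespace IsHermitian

/-- The orthogonal matrix of eigenvectors of a real symmetric matrix. -/
noncomputable def eigMatrix (hA : A.IsHermitian) : Matrix ι ι ℝ := hA.eigenvectorUnitary

lemma eigMatrix_transpose_mul_self (hA : A.IsHermitian) : hA.eigMatrixᵀ * hA.eigMatrix = 1 :=
  Unitary.coe_star_mul_self hA.eigenvectorUnitary

lemma eigMatrix_mul_transpose_self (hA : A.IsHermitian) : hA.eigMatrix * hA.eigMatrixᵀ = 1 :=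
  Unitary.coe_mul_star_self hA.eigenvectorUnitary

lemma eigMatrix_transpose_mul_cancel (hA : A.IsHermitian) (M : Matrix ι ι ℝ) :
    hA.eigMatrixᵀ * (hA.eigMatrix * M) = M := by
  rw [← Matrix.mul_assoc, eigMatrix_transpose_mul_self, Matrix.one_mul]

lemma eigMatrix_mul_transpose_cancel (hA : A.IsHermitian) (M : Matrix ι ι ℝ) :
    hA.eigMatrix * (hA.eigMatrixᵀ * M) = M := by
  rw [← Matrix.mul_assoc, eigMatrix_mul_transpose_self, Matrix.one_mul]

lemma cfc_eq_eigMatrix (hA : A.IsHermitian) (f : ℝ → ℝ) :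
    cfc f A = hA.eigMatrix * diagonal (fun i => f (hA.eigenvalues i)) * hA.eigMatrixᵀ := by
  rw [hA.cfc_eq, IsHermitian.cfc, Unitary.conjStarAlgAut_apply]
  rfl

lemma cfc_id_eq (hA : A.IsHermitian) : cfc (fun x : ℝ => x) A = A :=
  cfc_id' ℝ A hA.isSelfAdjoint

lemma eq_eigMatrix (hA : A.IsHermitian) :
    A = hA.eigMatrix * diagonal hA.eigenvalues * hA.eigMatrixᵀ := by
  rw [← hA.cfc_eq_eigMatrix fun x => x, hA.cfc_id_eq]

lemma cfc_mul_cfc (hA : A.IsHermitian) (f g : ℝ → ℝ) :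
    cfc f A * cfc g A = cfc (fun x => f x * g x) A := by
  simp only [hA.cfc_eq_eigMatrix, Matrix.mul_assoc, eigMatrix_transpose_mul_cancel]
  rw [← Matrix.mul_assoc (diagonal _) (diagonal _), diagonal_mul_diagonal]

lemma cfc_one_eq (hA : A.IsHermitian) : cfc (fun _ : ℝ => (1 : ℝ)) A = 1 := by
  rw [hA.cfc_eq_eigMatrix, diagonal_one, Matrix.mul_one, eigMatrix_mul_transpose_self]

lemma trace_cfc (hA : A.IsHermitian) (f : ℝ → ℝ) :
    trace (cfc f A) = ∑ i, f (hA.eigenvalues i) := by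
  rw [hA.cfc_eq_eigMatrix, trace_mul_comm, ← Matrix.mul_assoc, eigMatrix_transpose_mul_self,
    Matrix.one_mul, trace_diagonal]

/-- The matrix of inner products between the eigenvectors of two symmetric matrices. -/
noncomputable def overlap (hA : A.IsHermitian) (hB : B.IsHermitian) : Matrix ι ι ℝ :=
  hA.eigMatrixᵀ * hB.eigMatrix

lemma trace_cfc_mul_cfc (hA : A.IsHermitian) (hB : B.IsHermitian) (f g : ℝ → ℝ) :
    trace (cfc f A * cfc g B)
      = ∑ i, ∑ j, f (hA.eigenvalues i) * g (hB.eigenvalues j) * hA.overlap hB i j ^ 2 := by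
  have h := trace_diagonal_mul_mul_diagonal_mul_transpose (fun i => f (hA.eigenvalues i))
    (fun i => g (hB.eigenvalues i)) (hA.overlap hB) (hA.overlap hB)
  simp only [← sq] at h
  rw [← h, hA.cfc_eq_eigMatrix, hB.cfc_eq_eigMatrix, Matrix.mul_assoc, Matrix.mul_assoc,
    trace_mul_comm, overlap, transpose_mul, transpose_transpose]
  simp only [Matrix.mul_assoc]

end IsHermitian

/-- The quadratic expression in `Z`, affine in `(A, B)`, whose supremum over `Z` is
`Matrix.IsHermitian.divergence`. -/
noncomputable def divergenceForm {ι : Type*} [Fintype ι] (t : ℝ) (A B Z : Matrix ι ι ℝ) : ℝ :=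
  2 * trace ((A - B) * Zᵀ) - t * trace (A * Z * Zᵀ) - (1 - t) * trace (Z * B * Zᵀ)

lemma divergenceForm_sum {κ ι : Type*} [Fintype κ] [Fintype ι] (p : κ → ℝ) (t : ℝ)
    (A B : κ → Matrix ι ι ℝ) (Z : Matrix ι ι ℝ) :
    divergenceForm t (∑ x, p x • A x) (∑ x, p x • B x) Z
      = ∑ x, p x * divergenceForm t (A x) (B x) Z := by
  simp only [divergenceForm, ← Finset.sum_sub_distrib, ← smul_sub, Matrix.sum_mul,
    Matrix.smul_mul, Matrix.mul_smul, trace_sum, trace_smul, smul_eq_mul,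
    Finset.mul_sum]
  exact Finset.sum_congr rfl fun x _ => by ring

namespace IsHermitian

lemma divergenceForm_eq (hA : A.IsHermitian) (hB : B.IsHermitian) (t : ℝ) (M : Matrix ι ι ℝ) :
    divergenceForm t A B (hA.eigMatrix * M * hB.eigMatrixᵀ)
      = ∑ i, ∑ j, (2 * (hA.eigenvalues i - hB.eigenvalues j) * hA.overlap hB i j * M i j
          - (t * hA.eigenvalues i + (1 - t) * hB.eigenvalues j) * M i j ^ 2) := by
  set a := hA.eigenvalues with ha
  set b := hB.eigenvalues with hb
  set P := hA.eigMatrix with hP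
  set Q := hB.eigMatrix with hQ
  have eA : A = P * diagonal a * Pᵀ := hA.eq_eigMatrix
  have eB : B = Q * diagonal b * Qᵀ := hB.eq_eigMatrix
  have key := trace_diagonal_mul_mul_diagonal_mul_transpose (ι := ι)
  have h1 : trace (A * (P * M * Qᵀ)ᵀ)
      = ∑ i, ∑ j, a i * (hA.overlap hB i j * M i j) := by
    have := key a (fun _ => 1) (hA.overlap hB) M
    simp only [mul_one, diagonal_one] at this
    rw [← this, overlap, ← hP, ← hQ]
    conv_lhs => rw [eA]
    simp only [transpose_mul, transpose_transpose, Matrix.mul_assoc]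
    rw [trace_mul_comm]
    simp only [Matrix.mul_assoc]
    rw [hP, eigMatrix_transpose_mul_self, Matrix.mul_one]
  have h2 : trace (B * (P * M * Qᵀ)ᵀ)
      = ∑ i, ∑ j, b j * (hA.overlap hB i j * M i j) := by
    have := key (fun _ => 1) b (hA.overlap hB) M
    simp only [one_mul, diagonal_one] at this
    rw [← this, overlap, ← hP, ← hQ]
    conv_lhs => rw [eB]
    simp only [transpose_mul, transpose_transpose, Matrix.mul_assoc]
    rw [hQ, eigMatrix_transpose_mul_cancel, trace_mul_comm Pᵀ]
    simp only [Matrix.mul_assoc]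
  have h3 : trace (A * (P * M * Qᵀ) * (P * M * Qᵀ)ᵀ)
      = ∑ i, ∑ j, a i * (M i j * M i j) := by
    have := key a (fun _ => 1) M M
    simp only [mul_one, diagonal_one] at this
    rw [← this]
    conv_lhs => rw [eA]
    simp only [transpose_mul, transpose_transpose, Matrix.mul_assoc]
    rw [hP, hQ, eigMatrix_transpose_mul_cancel, eigMatrix_transpose_mul_cancel, trace_mul_comm]
    simp only [Matrix.mul_assoc]
    rw [eigMatrix_transpose_mul_self, Matrix.mul_one]
  have h4 : trace ((P * M * Qᵀ) * B * (P * M * Qᵀ)ᵀ)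
      = ∑ i, ∑ j, b j * (M i j * M i j) := by
    have := key (fun _ => 1) b M M
    simp only [one_mul, diagonal_one] at this
    rw [← this]
    conv_lhs => rw [eB]
    simp only [transpose_mul, transpose_transpose, Matrix.mul_assoc]
    rw [hP, hQ, eigMatrix_transpose_mul_cancel, eigMatrix_transpose_mul_cancel, trace_mul_comm]
    simp only [Matrix.mul_assoc]
    rw [eigMatrix_transpose_mul_self, Matrix.mul_one]
  rw [divergenceForm, Matrix.sub_mul, trace_sub, h1, h2, h3, h4]
  simp only [← Finset.sum_sub_distrib, Finset.mul_sum]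
  exact Finset.sum_congr rfl fun i _ => Finset.sum_congr rfl fun j _ => by ring

/-- The noncommutative version of `(a - b) ^ 2 / (t * a + (1 - t) * b)`. -/
noncomputable def divergence (hA : A.IsHermitian) (hB : B.IsHermitian) (t : ℝ) : ℝ :=
  ∑ i, ∑ j, (hA.eigenvalues i - hB.eigenvalues j) ^ 2
    / (t * hA.eigenvalues i + (1 - t) * hB.eigenvalues j) * hA.overlap hB i j ^ 2

end IsHermitian

lemma convexCombo_pos {a b t : ℝ} (ha : 0 < a) (hb : 0 < b) (ht : t ∈ Set.Icc (0 : ℝ) 1) :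
    0 < t * a + (1 - t) * b := by
  obtain ⟨h0, h1⟩ := ht
  rcases h0.eq_or_lt with rfl | h0
  · simpa using hb
  · have := mul_pos h0 ha
    have := mul_nonneg (sub_nonneg.2 h1) hb.le
    linarith

namespace PosDef

lemma divergenceForm_le (hA : A.PosDef) (hB : B.PosDef) {t : ℝ} (ht : t ∈ Set.Icc (0 : ℝ) 1)
    (Z : Matrix ι ι ℝ) : divergenceForm t A B Z ≤ hA.1.divergence hB.1 t := by
  have hZ : Z = hA.1.eigMatrix * (hA.1.eigMatrixᵀ * Z * hB.1.eigMatrix) * hB.1.eigMatrixᵀ := by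
    simp only [Matrix.mul_assoc, IsHermitian.eigMatrix_mul_transpose_cancel,
      IsHermitian.eigMatrix_mul_transpose_self, Matrix.mul_one]
  rw [hZ, hA.1.divergenceForm_eq hB.1]
  refine Finset.sum_le_sum fun i _ => Finset.sum_le_sum fun j _ => ?_
  have hc := convexCombo_pos (hA.eigenvalues_pos i) (hB.eigenvalues_pos j) ht
  generalize t * hA.1.eigenvalues i + (1 - t) * hB.1.eigenvalues j = c at hc ⊢
  generalize (hA.1.eigMatrixᵀ * Z * hB.1.eigMatrix) i j = m
  generalize hA.1.eigenvalues i - hB.1.eigenvalues j = x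
  generalize hA.1.overlap hB.1 i j = o
  rw [div_mul_eq_mul_div, le_div_iff₀ hc]
  nlinarith [sq_nonneg (x * o - c * m)]

lemma exists_divergenceForm_eq (hA : A.PosDef) (hB : B.PosDef) {t : ℝ}
    (ht : t ∈ Set.Icc (0 : ℝ) 1) :
    ∃ Z, divergenceForm t A B Z = hA.1.divergence hB.1 t := by
  refine ⟨hA.1.eigMatrix * (of fun i j => (hA.1.eigenvalues i - hB.1.eigenvalues j)
    / (t * hA.1.eigenvalues i + (1 - t) * hB.1.eigenvalues j) * hA.1.overlap hB.1 i j)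
    * hB.1.eigMatrixᵀ, ?_⟩
  rw [hA.1.divergenceForm_eq hB.1]
  refine Finset.sum_congr rfl fun i _ => Finset.sum_congr rfl fun j _ => ?_
  have hc := (convexCombo_pos (hA.eigenvalues_pos i) (hB.eigenvalues_pos j) ht).ne'
  rw [of_apply]
  field_simp
  ring

lemma sum_smul {κ ι : Type*} [Fintype κ] {p : κ → ℝ} (hp : ∀ x, 0 ≤ p x) (hp1 : ∑ x, p x = 1)
    {A : κ → Matrix ι ι ℝ} (hA : ∀ x, (A x).PosDef) : (∑ x, p x • A x).PosDef := by
  classical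
  obtain ⟨x₀, -, hx₀⟩ := Finset.exists_ne_zero_of_sum_ne_zero (hp1.trans_ne one_ne_zero)
  rw [← Finset.add_sum_erase _ _ (Finset.mem_univ x₀)]
  exact ((hA x₀).smul ((hp x₀).lt_of_ne' hx₀)).add_posSemidef
    (posSemidef_sum _ fun x _ => (hA x).posSemidef.smul (hp x))

lemma divergence_sum_le {κ : Type*} [Fintype κ] {p : κ → ℝ} (hp : ∀ x, 0 ≤ p x)
    {A B : κ → Matrix ι ι ℝ} (hA : ∀ x, (A x).PosDef) (hB : ∀ x, (B x).PosDef)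
    (hA' : (∑ x, p x • A x).PosDef) (hB' : (∑ x, p x • B x).PosDef)
    {t : ℝ} (ht : t ∈ Set.Icc (0 : ℝ) 1) :
    hA'.1.divergence hB'.1 t ≤ ∑ x, p x * (hA x).1.divergence (hB x).1 t := by
  obtain ⟨Z, hZ⟩ := hA'.exists_divergenceForm_eq hB' ht
  rw [← hZ, divergenceForm_sum]
  exact Finset.sum_le_sum fun x _ =>
    mul_le_mul_of_nonneg_left ((hA x).divergenceForm_le (hB x) ht Z) (hp x)

end PosDef

lemma hasDerivAt_relEntropy_primitive {a b t : ℝ} (h : 0 < t * a + (1 - t) * b) :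
    HasDerivAt (fun t => a * Real.log (t * a + (1 - t) * b) - (a - b) * t)
      ((1 - t) * ((a - b) ^ 2 / (t * a + (1 - t) * b))) t := by
  have h1 : HasDerivAt (fun t => t * a + (1 - t) * b) (a - b) t := by
    have := ((hasDerivAt_id' t).mul_const a).add (((hasDerivAt_id' t).const_sub 1).mul_const b)
    rwa [one_mul, neg_one_mul, ← sub_eq_add_neg] at this
  refine (((h1.log h.ne').const_mul a).sub
    ((hasDerivAt_id' t).const_mul (a - b))).congr_deriv ?_
  rw [eq_comm, ← sub_eq_zero]
  generalize hc : t * a + (1 - t) * b = c at h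
  have hc' : (1 - t) * (a - b) = a - c := by rw [← hc]; ring
  field_simp
  linear_combination (a - b) * hc'

lemma continuousOn_divergence_integrand {a b : ℝ} (ha : 0 < a) (hb : 0 < b) :
    ContinuousOn (fun t => (1 - t) * ((a - b) ^ 2 / (t * a + (1 - t) * b)))
      (Set.uIcc 0 1) := by
  rw [Set.uIcc_of_le zero_le_one]
  exact ContinuousOn.mul (by fun_prop) (ContinuousOn.div (by fun_prop) (by fun_prop)
    fun t ht => (convexCombo_pos ha hb ht).ne')

lemma integral_divergence_integrand {a b : ℝ} (ha : 0 < a) (hb : 0 < b) :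
    ∫ t in (0 : ℝ)..1, (1 - t) * ((a - b) ^ 2 / (t * a + (1 - t) * b))
      = a * Real.log a - a * Real.log b - a + b := by
  rw [intervalIntegral.integral_eq_sub_of_hasDerivAt
    (f := fun t => a * Real.log (t * a + (1 - t) * b) - (a - b) * t)
    (fun t ht => hasDerivAt_relEntropy_primitive (convexCombo_pos ha hb
      (by rwa [Set.uIcc_of_le zero_le_one] at ht)))
    (continuousOn_divergence_integrand ha hb).intervalIntegrable]
  simp
  ring

/-- The quantum relative entropy, normalized to be nonnegative for all positive definite
`A`, `B`. -/
noncomputable def relEntropy (A B : Matrix ι ι ℝ) : ℝ :=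
  trace (A * cfc Real.log A) - trace (A * cfc Real.log B) - trace A + trace B

lemma IsHermitian.relEntropy_eq (hA : A.IsHermitian) (hB : B.IsHermitian) :
    relEntropy A B = ∑ i, ∑ j, (hA.eigenvalues i * Real.log (hA.eigenvalues i)
      - hA.eigenvalues i * Real.log (hB.eigenvalues j) - hA.eigenvalues i + hB.eigenvalues j)
      * hA.overlap hB i j ^ 2 := by
  have h1 := hA.trace_cfc_mul_cfc hB (fun x => x * Real.log x) (fun _ => 1)
  have h2 := hA.trace_cfc_mul_cfc hB (fun x => x) Real.log
  have h3 := hA.trace_cfc_mul_cfc hB (fun x => x) (fun _ => 1)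
  have h4 := hA.trace_cfc_mul_cfc hB (fun _ => 1) (fun x => x)
  rw [← hA.cfc_mul_cfc (fun x => x)] at h1
  simp only [hA.cfc_id_eq, hB.cfc_id_eq, hA.cfc_one_eq, hB.cfc_one_eq, Matrix.mul_one,
    Matrix.one_mul] at h1 h2 h3 h4
  rw [relEntropy, h1, h2, h3, h4]
  simp only [← Finset.sum_sub_distrib, ← Finset.sum_add_distrib]
  exact Finset.sum_congr rfl fun i _ => Finset.sum_congr rfl fun j _ => by ring

namespace PosDef

lemma relEntropy_nonneg (hA : A.PosDef) (hB : B.PosDef) : 0 ≤ relEntropy A B := by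
  rw [hA.1.relEntropy_eq hB.1]
  refine Finset.sum_nonneg fun i _ => Finset.sum_nonneg fun j _ =>
    mul_nonneg ?_ (sq_nonneg _)
  have ha := hA.eigenvalues_pos i
  have hb := hB.eigenvalues_pos j
  have h := mul_le_mul_of_nonneg_left (Real.log_le_sub_one_of_pos (div_pos hb ha)) ha.le
  rw [Real.log_div hb.ne' ha.ne', mul_sub, mul_sub, mul_div_cancel₀ _ ha.ne'] at h
  linarith

lemma intervalIntegrable_divergence (hA : A.PosDef) (hB : B.PosDef) :
    IntervalIntegrable (fun t => (1 - t) * hA.1.divergence hB.1 t) MeasureTheory.volume 0 1 := by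
  refine ContinuousOn.intervalIntegrable ?_
  simp only [IsHermitian.divergence, Finset.mul_sum, ← mul_assoc]
  refine continuousOn_finsetSum _ fun i _ => continuousOn_finsetSum _ fun j _ => ?_
  exact (continuousOn_divergence_integrand (hA.eigenvalues_pos i)
    (hB.eigenvalues_pos j)).mul continuousOn_const

lemma relEntropy_eq_integral (hA : A.PosDef) (hB : B.PosDef) :
    relEntropy A B = ∫ t in (0 : ℝ)..1, (1 - t) * hA.1.divergence hB.1 t := by
  have hint : ∀ i j, IntervalIntegrable (fun t => (1 - t) * ((hA.1.eigenvalues i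
      - hB.1.eigenvalues j) ^ 2 / (t * hA.1.eigenvalues i + (1 - t) * hB.1.eigenvalues j))
      * hA.1.overlap hB.1 i j ^ 2) MeasureTheory.volume 0 1 := fun i j =>
    (continuousOn_divergence_integrand (hA.eigenvalues_pos i)
      (hB.eigenvalues_pos j)).intervalIntegrable.mul_const _
  simp only [IsHermitian.divergence, Finset.mul_sum, ← mul_assoc]
  rw [hA.1.relEntropy_eq hB.1, intervalIntegral.integral_finsetSum]
  · refine Finset.sum_congr rfl fun i _ => ?_
    rw [intervalIntegral.integral_finsetSum fun j _ => hint i j]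
    refine Finset.sum_congr rfl fun j _ => ?_
    rw [intervalIntegral.integral_mul_const,
      integral_divergence_integrand (hA.eigenvalues_pos i) (hB.eigenvalues_pos j)]
  · intro i _
    simpa only [Finset.sum_fn] using IntervalIntegrable.sum Finset.univ fun j _ => hint i j

/-- Joint convexity of the quantum relative entropy. -/
lemma relEntropy_sum_le {κ : Type*} [Fintype κ] {p : κ → ℝ} (hp : ∀ x, 0 ≤ p x)
    (hp1 : ∑ x, p x = 1) {A B : κ → Matrix ι ι ℝ}
    (hA : ∀ x, (A x).PosDef) (hB : ∀ x, (B x).PosDef) :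
    relEntropy (∑ x, p x • A x) (∑ x, p x • B x) ≤ ∑ x, p x * relEntropy (A x) (B x) := by
  have hA' := PosDef.sum_smul hp hp1 hA
  have hB' := PosDef.sum_smul hp hp1 hB
  have hint : ∀ x, IntervalIntegrable
      (fun t => p x * ((1 - t) * (hA x).1.divergence (hB x).1 t)) MeasureTheory.volume 0 1 :=
    fun x => ((hA x).intervalIntegrable_divergence (hB x)).const_mul _
  simp only [(hA _).relEntropy_eq_integral (hB _), hA'.relEntropy_eq_integral hB',
    ← intervalIntegral.integral_const_mul]
  rw [← intervalIntegral.integral_finsetSum fun x _ => hint x]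
  refine intervalIntegral.integral_mono_on zero_le_one
    (hA'.intervalIntegrable_divergence hB') ?_ fun t ht => ?_
  · simpa only [Finset.sum_fn] using IntervalIntegrable.sum Finset.univ fun x _ => hint x
  · have h := mul_le_mul_of_nonneg_left (divergence_sum_le hp hA hB hA' hB' ht)
      (sub_nonneg.2 ht.2)
    refine h.trans_eq ?_
    rw [Finset.mul_sum]
    exact Finset.sum_congr rfl fun x _ => by ring

end PosDef

end Matrix

namespace Matrix

variable {ι : Type*} [Fintype ι] [DecidableEq ι] {A B : Matrix ι ι ℝ}

lemma isHermitian_cfc (f : ℝ → ℝ) (A : Matrix ι ι ℝ) : (cfc f A).IsHermitian :=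
  (cfc_predicate f A : IsSelfAdjoint (cfc f A))

lemma IsHermitian.cfc_cfc (hA : A.IsHermitian) (f g : ℝ → ℝ) :
    cfc g (cfc f A) = cfc (fun x => g (f x)) A :=
  (cfc_comp' g f A ((A.finite_real_spectrum.image f).continuousOn g)
    (A.finite_real_spectrum.continuousOn f) hA.isSelfAdjoint).symm

lemma IsHermitian.posDef_cfc (hA : A.IsHermitian) {f : ℝ → ℝ}
    (hf : ∀ i, 0 < f (hA.eigenvalues i)) : (cfc f A).PosDef := by
  rw [hA.cfc_eq_eigMatrix]
  refine PosDef.mul_mul_conjTranspose_same (PosDef.diagonal hf) fun x y h => ?_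
  simpa [vecMul_vecMul, eigMatrix_mul_transpose_self] using
    congrArg (fun v => v ᵥ* hA.eigMatrixᵀ) h

lemma IsHermitian.posDef_cfc_exp (hA : A.IsHermitian) : (cfc Real.exp A).PosDef :=
  hA.posDef_cfc fun _ => Real.exp_pos _

lemma IsHermitian.log_exp (hA : A.IsHermitian) : cfc Real.log (cfc Real.exp A) = A := by
  rw [hA.cfc_cfc]
  simp only [Real.log_exp]
  exact hA.cfc_id_eq

/-- A form of Lieb's theorem: concavity of `Y ↦ trace (exp (H + log Y))`, evaluated at
exponentials. -/
lemma sum_mul_trace_exp_add_le {κ : Type*} [Fintype κ] {p : κ → ℝ} (hp : ∀ x, 0 ≤ p x)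
    (hp1 : ∑ x, p x = 1) {H : Matrix ι ι ℝ} (hH : H.IsHermitian) {X : κ → Matrix ι ι ℝ}
    (hX : ∀ x, (X x).IsHermitian) :
    ∑ x, p x * trace (cfc Real.exp (H + X x))
      ≤ trace (cfc Real.exp (H + cfc Real.log (∑ x, p x • cfc Real.exp (X x)))) := by
  have hT : ∀ x, (cfc Real.exp (H + X x)).PosDef := fun x => (hH.add (hX x)).posDef_cfc_exp
  have hY : ∀ x, (cfc Real.exp (X x)).PosDef := fun x => (hX x).posDef_cfc_exp
  have hE := hH.add (isHermitian_cfc Real.log (∑ x, p x • cfc Real.exp (X x)))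
  have h1 := PosDef.relEntropy_sum_le hp hp1 hT hY
  have h2 := (PosDef.sum_smul hp hp1 hT).relEntropy_nonneg hE.posDef_cfc_exp
  simp only [relEntropy, (hH.add (hX _)).log_exp, (hX _).log_exp, hE.log_exp] at h1 h2
  simp only [Matrix.mul_add, trace_add] at h1 h2
  have h3 : ∑ x, p x * (trace (cfc Real.exp (H + X x) * H)
        + trace (cfc Real.exp (H + X x) * X x) - trace (cfc Real.exp (H + X x) * X x)
        - trace (cfc Real.exp (H + X x)) + trace (cfc Real.exp (X x)))
      = trace ((∑ x, p x • cfc Real.exp (H + X x)) * H)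
        - trace (∑ x, p x • cfc Real.exp (H + X x)) + trace (∑ x, p x • cfc Real.exp (X x)) := by
    simp only [Matrix.sum_mul, trace_sum, Matrix.smul_mul, trace_smul, smul_eq_mul,
      ← Finset.sum_sub_distrib, ← Finset.sum_add_distrib]
    exact Finset.sum_congr rfl fun x _ => by ring
  have h4 : ∑ x, p x * trace (cfc Real.exp (H + X x))
      = trace (∑ x, p x • cfc Real.exp (H + X x)) := by
    simp only [trace_sum, trace_smul, smul_eq_mul]
  linarith

end Matrix

section Expectation

variable {n : ℕ} {p : Fin n → ℝ}

lemma expec_succ {s : ℕ} (f : (Fin (s + 1) → Fin n) → ℝ) :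
    expec p f = ∑ x, p x * expec p fun ω : Fin s → Fin n => f (Fin.cons x ω) := by
  simp only [expec]
  rw [← (Fin.consEquiv fun _ => Fin n).sum_comp, Fintype.sum_prod_type]
  refine Finset.sum_congr rfl fun x _ => ?_
  rw [Finset.mul_sum]
  refine Finset.sum_congr rfl fun ω _ => ?_
  simp [Fin.consEquiv, Fin.prod_univ_succ, mul_assoc]

lemma expec_sub {s : ℕ} (f g : (Fin s → Fin n) → ℝ) :
    expec p (fun ω => f ω - g ω) = expec p f - expec p g := by
  simp only [expec, mul_sub, Finset.sum_sub_distrib]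

lemma expec_const_mul {s : ℕ} (c : ℝ) (f : (Fin s → Fin n) → ℝ) :
    expec p (fun ω => c * f ω) = c * expec p f := by
  simp only [expec, Finset.mul_sum, mul_left_comm]

lemma expec_const (hp1 : ∑ x, p x = 1) (s : ℕ) (c : ℝ) :
    expec p (fun _ : Fin s → Fin n => c) = c := by
  induction s with
  | zero => simp [expec]
  | succ s ih => rw [expec_succ, ih, ← Finset.sum_mul, hp1, one_mul]

lemma expec_sum_eq_zero (hp1 : ∑ x, p x = 1) {f : Fin n → ℝ} (hf : ∑ x, p x * f x = 0) (s : ℕ) :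
    expec p (fun ω : Fin s → Fin n => ∑ i, f (ω i)) = 0 := by
  induction s with
  | zero => simp [expec]
  | succ s ih =>
    have h : ∀ x, expec p (fun ω : Fin s → Fin n =>
        ∑ i, f ((Fin.cons x ω : Fin (s + 1) → Fin n) i)) = f x := fun x => by
      have h := expec_sub (p := p) (fun _ : Fin s → Fin n => f x) fun ω => -∑ i, f (ω i)
      have h' := expec_const_mul (p := p) (-1) fun ω : Fin s → Fin n => ∑ i, f (ω i)
      simp only [neg_one_mul] at h'
      rw [expec_const hp1, h', ih] at h
      simpa [Fin.sum_univ_succ] using h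
    rw [expec_succ]
    simp only [h, hf]

open Matrix in
/-- Subadditivity of the matrix cumulant generating function for i.i.d. sums. -/
lemma expec_trace_exp_add_sum_le {ι : Type*} [Fintype ι] [DecidableEq ι] (hp : ∀ x, 0 ≤ p x)
    (hp1 : ∑ x, p x = 1) {X : Fin n → Matrix ι ι ℝ} (hX : ∀ x, (X x).IsHermitian) (s : ℕ)
    {H : Matrix ι ι ℝ} (hH : H.IsHermitian) :
    expec p (fun ω : Fin s → Fin n => trace (cfc Real.exp (H + ∑ i, X (ω i))))
      ≤ trace (cfc Real.exp (H + (s : ℝ) • cfc Real.log (∑ x, p x • cfc Real.exp (X x)))) := by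
  set L := cfc Real.log (∑ x, p x • cfc Real.exp (X x)) with hL
  have hLh : L.IsHermitian := isHermitian_cfc _ _
  have hsL : ∀ s : ℕ, ((s : ℝ) • L).IsHermitian := fun s => by
    rw [IsHermitian, conjTranspose_smul, hLh, star_trivial]
  induction s generalizing H with
  | zero => simp [expec]
  | succ s ih =>
    rw [expec_succ]
    simp only [Fin.sum_univ_succ, Fin.cons_zero, Fin.cons_succ, ← add_assoc]
    calc _ ≤ ∑ x, p x * trace (cfc Real.exp (H + X x + (s : ℝ) • L)) :=
          Finset.sum_le_sum fun x _ => mul_le_mul_of_nonneg_left (ih (hH.add (hX x))) (hp x)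
      _ = ∑ x, p x * trace (cfc Real.exp (H + (s : ℝ) • L + X x)) := by
          simp only [add_right_comm]
      _ ≤ _ := by
          refine (sum_mul_trace_exp_add_le hp hp1 (hH.add (hsL s)) hX).trans_eq ?_
          rw [← hL, Nat.cast_add_one, add_smul, one_smul, add_assoc]

end Expectation

/-- The quadratic upper bound for the exponential behind Bernstein's inequality. -/
lemma Real.exp_le_one_add_add_sq {x y : ℝ} (hxy : |x| ≤ y) (hy : y < 3) :
    Real.exp x ≤ 1 + x + x ^ 2 / (2 * (1 - y / 3)) := by
  have hy0 : 0 ≤ y := (abs_nonneg x).trans hxy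
  have h1 : HasSum (fun m : ℕ => x ^ (m + 2) / (m + 2).factorial) (Real.exp x - (1 + x)) := by
    have h := NormedSpace.expSeries_div_hasSum_exp (𝔸 := ℝ) x
    rw [← Real.exp_eq_exp_ℝ, ← hasSum_nat_add_iff' 2] at h
    simpa [Finset.sum_range_succ] using h
  have h2 := (hasSum_geometric_of_lt_one (by positivity : 0 ≤ y / 3)
    (by linarith)).mul_left (x ^ 2 / 2)
  have h3 := hasSum_le (fun m => ?_) h1 h2
  · have e : x ^ 2 / (2 * (1 - y / 3)) = x ^ 2 / 2 * (1 - y / 3)⁻¹ := by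
      rw [div_mul_eq_div_div, div_eq_mul_inv]
    linarith
  · have hf : (2 * 3 ^ m : ℝ) ≤ ((m + 2).factorial : ℝ) := by
      rw [add_comm m]
      exact_mod_cast Nat.factorial_mul_pow_le_factorial (m := 2) (n := m)
    calc x ^ (m + 2) / (m + 2).factorial ≤ x ^ 2 * y ^ m / (m + 2).factorial := by
          rw [pow_add, mul_comm]
          refine div_le_div_of_nonneg_right (mul_le_mul_of_nonneg_left ?_ (sq_nonneg x))
            (Nat.cast_nonneg _)
          exact (le_abs_self _).trans ((abs_pow x m).trans_le (by gcongr))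
      _ ≤ x ^ 2 * y ^ m / (2 * 3 ^ m) := by gcongr
      _ = x ^ 2 / 2 * (y / 3) ^ m := by
          rw [div_pow, div_mul_div_comm]

namespace Matrix

variable {ι : Type*} [Fintype ι] [DecidableEq ι] {A : Matrix ι ι ℝ}

namespace IsHermitian

lemma dotProduct_cfc_mulVec (hA : A.IsHermitian) (f : ℝ → ℝ) (v : ι → ℝ) :
    v ⬝ᵥ cfc f A *ᵥ v = ∑ i, f (hA.eigenvalues i) * (hA.eigMatrixᵀ *ᵥ v) i ^ 2 := by
  rw [hA.cfc_eq_eigMatrix, ← mulVec_mulVec, ← mulVec_mulVec, dotProduct_mulVec, dotProduct]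
  refine Finset.sum_congr rfl fun i _ => ?_
  rw [mulVec_diagonal, mulVec_transpose]
  ring

lemma dotProduct_self_eq (hA : A.IsHermitian) (v : ι → ℝ) :
    v ⬝ᵥ v = ∑ i, (hA.eigMatrixᵀ *ᵥ v) i ^ 2 := by
  simpa [hA.cfc_one_eq] using hA.dotProduct_cfc_mulVec (fun _ => 1) v

lemma dotProduct_mulVec_eq (hA : A.IsHermitian) (v : ι → ℝ) :
    v ⬝ᵥ A *ᵥ v = ∑ i, hA.eigenvalues i * (hA.eigMatrixᵀ *ᵥ v) i ^ 2 := by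
  simpa [hA.cfc_id_eq] using hA.dotProduct_cfc_mulVec (fun x => x) v

lemma eigMatrix_transpose_mulVec_col (hA : A.IsHermitian) (i : ι) :
    hA.eigMatrixᵀ *ᵥ hA.eigMatrix.col i = Pi.single i 1 := by
  rw [← mulVec_single_one, mulVec_mulVec, eigMatrix_transpose_mul_self, one_mulVec]

lemma eigenvalues_eq_dotProduct_col (hA : A.IsHermitian) (i : ι) :
    hA.eigenvalues i = hA.eigMatrix.col i ⬝ᵥ A *ᵥ hA.eigMatrix.col i := by
  rw [hA.dotProduct_mulVec_eq, eigMatrix_transpose_mulVec_col]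
  simp [Pi.single_apply]

lemma col_dotProduct_col_self (hA : A.IsHermitian) (i : ι) :
    hA.eigMatrix.col i ⬝ᵥ hA.eigMatrix.col i = 1 := by
  rw [hA.dotProduct_self_eq, eigMatrix_transpose_mulVec_col]
  simp [Pi.single_apply]

lemma sum_eigMatrix_sq (hA : A.IsHermitian) (j : ι) : ∑ i, hA.eigMatrix j i ^ 2 = 1 := by
  have h := congrFun (congrFun hA.eigMatrix_mul_transpose_self j) j
  simpa [mul_apply, ← sq] using h

lemma dotProduct_exp_mulVec_le (hA : A.IsHermitian) {y : ℝ} (hy : y < 3)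
    (hAy : ∀ v, |v ⬝ᵥ A *ᵥ v| ≤ y * (v ⬝ᵥ v)) (v : ι → ℝ) :
    v ⬝ᵥ cfc Real.exp A *ᵥ v
      ≤ v ⬝ᵥ v + v ⬝ᵥ A *ᵥ v + v ⬝ᵥ (A * A) *ᵥ v / (2 * (1 - y / 3)) := by
  have hsq := hA.dotProduct_cfc_mulVec (fun x => x * x) v
  rw [← hA.cfc_mul_cfc, hA.cfc_id_eq] at hsq
  rw [hsq, hA.dotProduct_cfc_mulVec, hA.dotProduct_self_eq, hA.dotProduct_mulVec_eq,
    Finset.sum_div, ← Finset.sum_add_distrib, ← Finset.sum_add_distrib]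
  refine Finset.sum_le_sum fun i _ => ?_
  have hi : |hA.eigenvalues i| ≤ y := by
    have h := hAy (hA.eigMatrix.col i)
    rwa [← hA.eigenvalues_eq_dotProduct_col, col_dotProduct_col_self, mul_one] at h
  refine (mul_le_mul_of_nonneg_right (Real.exp_le_one_add_add_sq hi hy)
    (sq_nonneg _)).trans_eq ?_
  ring

lemma smul_cfc (hA : A.IsHermitian) (c : ℝ) (f : ℝ → ℝ) :
    c • cfc f A = cfc (fun x => c * f x) A := by
  rw [hA.cfc_eq_eigMatrix, hA.cfc_eq_eigMatrix, ← Matrix.smul_mul, ← Matrix.mul_smul,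
    ← diagonal_smul]
  rfl

/-- The trace of `M ^ s`, written as `exp (s * log M)`, for `M ≤ 1 + g • diagonal D`. -/
lemma trace_exp_smul_log_le (hA : A.PosDef) {g : ℝ} {D : ι → ℝ}
    (hD0 : ∀ i, 0 ≤ D i) (hD1 : ∀ i, D i ≤ 1)
    (hAD : ∀ v, v ⬝ᵥ A *ᵥ v ≤ v ⬝ᵥ v + g * ∑ i, D i * v i ^ 2) {s : ℝ} (hs : 0 ≤ s) :
    trace (cfc Real.exp (s • cfc Real.log A))
      ≤ Fintype.card ι + (∑ i, D i) * (Real.exp (s * g) - 1) := by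
  rw [hA.1.smul_cfc, hA.1.cfc_cfc, hA.1.trace_cfc]
  have key : ∀ i, Real.exp (s * Real.log (hA.1.eigenvalues i))
      ≤ 1 + (∑ j, D j * hA.1.eigMatrix j i ^ 2) * (Real.exp (s * g) - 1) := fun i => by
    set q := ∑ j, D j * hA.1.eigMatrix j i ^ 2 with hq
    have hcol := hA.1.col_dotProduct_col_self i
    have hq0 : 0 ≤ q := Finset.sum_nonneg fun j _ => mul_nonneg (hD0 j) (sq_nonneg _)
    have hq1 : q ≤ 1 := by
      rw [← hcol]
      refine Finset.sum_le_sum fun j _ => ?_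
      rw [col_apply, ← sq]
      exact mul_le_of_le_one_left (sq_nonneg _) (hD1 j)
    have hμ : hA.1.eigenvalues i ≤ 1 + g * q := by
      have h := hAD (hA.1.eigMatrix.col i)
      rwa [← hA.1.eigenvalues_eq_dotProduct_col, hcol] at h
    have hlog := Real.log_le_sub_one_of_pos (hA.eigenvalues_pos i)
    have hconv := convexOn_exp.2 (Set.mem_univ (s * g)) (Set.mem_univ 0) hq0
      (sub_nonneg.2 hq1) (add_sub_cancel q 1)
    simp only [smul_eq_mul, mul_zero, add_zero, Real.exp_zero, mul_one] at hconv
    calc _ ≤ Real.exp (q * (s * g)) := by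
          rw [Real.exp_le_exp, show q * (s * g) = s * (g * q) by ring]
          exact mul_le_mul_of_nonneg_left (by linarith) hs
      _ ≤ _ := by linarith
  refine (Finset.sum_le_sum fun i _ => key i).trans_eq ?_
  rw [Finset.sum_add_distrib, ← Finset.sum_mul, Finset.sum_comm]
  simp only [← Finset.mul_sum, sum_eigMatrix_sq, mul_one, Finset.sum_const, Finset.card_univ,
    nsmul_eq_mul]

end IsHermitian

end Matrix

section Tail

variable {n s : ℕ} {p : Fin n → ℝ}

lemma probOf_le_add (hp : ∀ x, 0 ≤ p x) {E F G : (Fin s → Fin n) → Prop}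
    (h : ∀ ω, E ω → F ω ∨ G ω) : probOf p E ≤ probOf p F + probOf p G := by
  classical
  simp only [probOf, ← Finset.sum_add_distrib]
  refine Finset.sum_le_sum fun ω _ => ?_
  have hω : 0 ≤ ∏ i, p (ω i) := Finset.prod_nonneg fun i _ => hp (ω i)
  have := h ω
  split_ifs <;> first | linarith | tauto

lemma probOf_mul_le_expec (hp : ∀ x, 0 ≤ p x) {E : (Fin s → Fin n) → Prop}
    {f : (Fin s → Fin n) → ℝ} {c : ℝ} (hf : ∀ ω, 0 ≤ f ω) (hE : ∀ ω, E ω → c ≤ f ω) :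
    probOf p E * c ≤ expec p f := by
  classical
  rw [probOf, expec, Finset.sum_mul]
  refine Finset.sum_le_sum fun ω _ => ?_
  have hω : 0 ≤ ∏ i, p (ω i) := Finset.prod_nonneg fun i _ => hp (ω i)
  split_ifs with h
  · exact mul_le_mul_of_nonneg_left (hE ω h) hω
  · rw [zero_mul]
    exact mul_nonneg hω (hf ω)

namespace Matrix

variable {ι : Type*} [Fintype ι] [DecidableEq ι]

lemma isHermitian_sum_finset {κ ι : Type*} {S : Finset κ} {X : κ → Matrix ι ι ℝ}
    (hX : ∀ x, (X x).IsHermitian) : (∑ x ∈ S, X x).IsHermitian := by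
  rw [IsHermitian, conjTranspose_sum]
  exact Finset.sum_congr rfl fun x _ => hX x

lemma expec_trace_exp_sum_le (hp : ∀ x, 0 ≤ p x) (hp1 : ∑ x, p x = 1)
    {X : Fin n → Matrix ι ι ℝ} (hX : ∀ x, (X x).IsHermitian)
    (hmean : ∑ x, p x • X x = 0) {y c : ℝ} (hy : y < 3)
    (hXy : ∀ x v, |v ⬝ᵥ X x *ᵥ v| ≤ y * (v ⬝ᵥ v)) {D : ι → ℝ}
    (hD0 : ∀ i, 0 ≤ D i) (hD1 : ∀ i, D i ≤ 1)
    (hvar : ∀ v, v ⬝ᵥ (∑ x, p x • (X x * X x)) *ᵥ v ≤ c * ∑ i, D i * v i ^ 2) :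
    expec p (fun ω : Fin s → Fin n => trace (cfc Real.exp (∑ i, X (ω i))))
      ≤ Fintype.card ι + (∑ i, D i) * (Real.exp (s * (c / (2 * (1 - y / 3)))) - 1) := by
  have h := expec_trace_exp_add_sum_le hp hp1 hX s (isHermitian_zero (n := ι) (α := ℝ))
  simp only [zero_add] at h
  refine h.trans (IsHermitian.trace_exp_smul_log_le
    (PosDef.sum_smul hp hp1 fun x => (hX x).posDef_cfc_exp) hD0 hD1 (fun v => ?_)
    (Nat.cast_nonneg s))
  have hlin : ∀ Y : Fin n → Matrix ι ι ℝ,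
      v ⬝ᵥ (∑ x, p x • Y x) *ᵥ v = ∑ x, p x * (v ⬝ᵥ Y x *ᵥ v) := fun Y => by
    simp only [sum_mulVec, dotProduct_sum, smul_mulVec, dotProduct_smul, smul_eq_mul]
  have hm : ∑ x, p x * (v ⬝ᵥ X x *ᵥ v) = 0 := by rw [← hlin, hmean]; simp
  have hv := hvar v
  rw [hlin] at hv ⊢
  have hy' : 0 < 2 * (1 - y / 3) := by linarith
  calc _ ≤ ∑ x, p x * (v ⬝ᵥ v + v ⬝ᵥ X x *ᵥ v
        + v ⬝ᵥ (X x * X x) *ᵥ v / (2 * (1 - y / 3))) :=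
        Finset.sum_le_sum fun x _ => mul_le_mul_of_nonneg_left
          ((hX x).dotProduct_exp_mulVec_le hy (hXy x) v) (hp x)
    _ = v ⬝ᵥ v + (∑ x, p x * (v ⬝ᵥ (X x * X x) *ᵥ v)) / (2 * (1 - y / 3)) := by
        simp only [mul_add, Finset.sum_add_distrib, hm, add_zero, ← Finset.sum_mul, hp1, one_mul,
          Finset.sum_div, mul_div_assoc]
    _ ≤ _ := by
        rw [div_mul_eq_mul_div]
        gcongr

/-- Matrix Bernstein inequality with intrinsic dimension, before optimizing the scale. -/
lemma probOf_mul_le (hp : ∀ x, 0 ≤ p x) (hp1 : ∑ x, p x = 1)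
    {X : Fin n → Matrix ι ι ℝ} (hX : ∀ x, (X x).IsHermitian)
    (hmean : ∑ x, p x • X x = 0) {y c : ℝ} (hy : y < 3)
    (hXy : ∀ x v, |v ⬝ᵥ X x *ᵥ v| ≤ y * (v ⬝ᵥ v)) {D : ι → ℝ}
    (hD0 : ∀ i, 0 ≤ D i) (hD1 : ∀ i, D i ≤ 1)
    (hvar : ∀ v, v ⬝ᵥ (∑ x, p x • (X x * X x)) *ᵥ v ≤ c * ∑ i, D i * v i ^ 2)
    {a : ℝ} (ha : 0 ≤ a) :
    probOf p (fun ω : Fin s → Fin n => ∃ v, v ⬝ᵥ v = 1 ∧ a ≤ v ⬝ᵥ (∑ i, X (ω i)) *ᵥ v)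
        * (Real.exp a - a - 1)
      ≤ (∑ i, D i) * (Real.exp (s * (c / (2 * (1 - y / 3)))) - 1) := by
  have hS : ∀ ω : Fin s → Fin n, (∑ i, X (ω i)).IsHermitian := fun ω =>
    isHermitian_sum_finset fun i => hX (ω i)
  have htr : ∀ ω : Fin s → Fin n,
      trace (cfc Real.exp (∑ i, X (ω i))) - ∑ i, trace (X (ω i)) - Fintype.card ι
        = ∑ j, (Real.exp ((hS ω).eigenvalues j) - (hS ω).eigenvalues j - 1) := fun ω => by
    rw [(hS ω).trace_cfc, ← trace_sum, (hS ω).trace_eq_sum_eigenvalues]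
    simp [Finset.sum_sub_distrib]
  have hnn : ∀ x : ℝ, 0 ≤ Real.exp x - x - 1 := fun x => by linarith [Real.add_one_le_exp x]
  have hmarkov := probOf_mul_le_expec (s := s) (c := Real.exp a - a - 1)
    (f := fun ω => trace (cfc Real.exp (∑ i, X (ω i))) - ∑ i, trace (X (ω i)) - Fintype.card ι)
    (E := fun ω => ∃ v, v ⬝ᵥ v = 1 ∧ a ≤ v ⬝ᵥ (∑ i, X (ω i)) *ᵥ v) hp
    (fun ω => by rw [htr]; exact Finset.sum_nonneg fun j _ => hnn _)
    (fun ω ⟨v, hv, hav⟩ => by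
      have hne : Nonempty ι := by
        by_contra h
        rw [not_nonempty_iff] at h
        simp [dotProduct] at hv
      obtain ⟨j, hj⟩ := Finite.exists_max (hS ω).eigenvalues
      have haj : a ≤ (hS ω).eigenvalues j := by
        refine hav.trans ?_
        rw [(hS ω).dotProduct_mulVec_eq, ← mul_one ((hS ω).eigenvalues j), ← hv,
          (hS ω).dotProduct_self_eq, Finset.mul_sum]
        exact Finset.sum_le_sum fun i _ => mul_le_mul_of_nonneg_right (hj i) (sq_nonneg _)
      rw [htr]
      refine le_trans ?_ (Finset.single_le_sum (fun j _ => hnn _) (Finset.mem_univ j))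
      have h1 := Real.add_one_le_exp ((hS ω).eigenvalues j - a)
      have h2 := Real.one_le_exp ha
      have h3 : Real.exp ((hS ω).eigenvalues j)
          = Real.exp a * Real.exp ((hS ω).eigenvalues j - a) := by
        rw [← Real.exp_add, add_sub_cancel]
      nlinarith)
  have hmean' : expec p (fun ω : Fin s → Fin n => ∑ i, trace (X (ω i))) = 0 :=
    expec_sum_eq_zero hp1 (by
      simpa only [trace_sum, trace_smul, smul_eq_mul, trace_zero] using congrArg trace hmean) s
  rw [expec_sub, expec_sub, expec_const hp1, hmean', sub_zero] at hmarkov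
  linarith [expec_trace_exp_sum_le (s := s) hp hp1 hX hmean hy hXy hD0 hD1 hvar]

/-- One-sided tail bound for averages of i.i.d. symmetric matrices bounded by `L`. -/
lemma probOf_le_of_sample_size (hp : ∀ x, 0 ≤ p x) (hp1 : ∑ x, p x = 1)
    {Z : Fin n → Matrix ι ι ℝ} (hZ : ∀ x, (Z x).IsHermitian)
    (hmean : ∑ x, p x • Z x = 0) {L : ℝ} (hL : 0 < L)
    (hZL : ∀ x v, |v ⬝ᵥ Z x *ᵥ v| ≤ L * (v ⬝ᵥ v)) {D : ι → ℝ}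
    (hD0 : ∀ i, 0 ≤ D i) (hD1 : ∀ i, D i ≤ 1) (hDL : ∑ i, D i ≤ L)
    (hvar : ∀ v, v ⬝ᵥ (∑ x, p x • (Z x * Z x)) *ᵥ v ≤ L * ∑ i, D i * v i ^ 2)
    {ε K : ℝ} (hε : 0 < ε) (hK : 3 ≤ K)
    (hs : (1 + ε / 3) * (2 * L * Real.log K) / ε ^ 2 ≤ s) :
    probOf p (fun ω : Fin s → Fin n => ∃ v, v ⬝ᵥ v = 1 ∧ s * ε ≤ v ⬝ᵥ (∑ i, Z (ω i)) *ᵥ v)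
      ≤ 2 * L / K := by
  set θ := ε / (L * (1 + ε / 3)) with hθ
  have hε3 : 0 < 1 + ε / 3 := by positivity
  have hθ0 : 0 < θ := by positivity
  have hθL : θ * L = ε / (1 + ε / 3) := by rw [hθ]; field_simp
  have hy : θ * L < 3 := by
    rw [hθL, div_lt_iff₀ hε3]; linarith
  set c := s * ε ^ 2 / (2 * L * (1 + ε / 3)) with hc
  have hlog : Real.log K ≤ c := by
    rw [div_le_iff₀ (by positivity)] at hs
    rw [hc, le_div_iff₀ (by positivity)]
    linarith
  have hKc : K ≤ Real.exp c := (Real.log_le_iff_le_exp (by linarith)).1 hlog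
  have hc1 : 1 ≤ c := by
    refine le_trans ?_ hlog
    rw [Real.le_log_iff_exp_le (by linarith)]
    linarith [Real.exp_one_lt_d9]
  have h1 : s * (θ ^ 2 * L / (2 * (1 - θ * L / 3))) = c := by
    rw [hθL, hc, hθ]
    have : 1 - ε / (1 + ε / 3) / 3 = 1 / (1 + ε / 3) := by field_simp; ring
    rw [this]
    field_simp
  have h2 : θ * (s * ε) = 2 * c := by rw [hc, hθ]; field_simp
  have hB := probOf_mul_le (s := s) (X := fun x => θ • Z x) (y := θ * L) (c := θ ^ 2 * L) (D := D)
    (a := 2 * c) hp hp1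
    (fun x => by rw [IsHermitian, conjTranspose_smul, hZ x, star_trivial])
    (by simp only [smul_comm _ θ, ← Finset.smul_sum, hmean, smul_zero]) hy
    (fun x v => by
      rw [smul_mulVec, dotProduct_smul, smul_eq_mul, abs_mul, abs_of_pos hθ0, mul_assoc]
      exact mul_le_mul_of_nonneg_left (hZL x v) hθ0.le) hD0 hD1
    (fun v => by
      have : ∑ x, p x • (θ • Z x * θ • Z x) = θ ^ 2 • ∑ x, p x • (Z x * Z x) := by
        rw [Finset.smul_sum]
        refine Finset.sum_congr rfl fun x _ => ?_
        rw [Matrix.smul_mul, Matrix.mul_smul]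
        simp only [smul_smul]
        congr 1
        ring
      rw [this, smul_mulVec, dotProduct_smul, smul_eq_mul, mul_assoc]
      exact mul_le_mul_of_nonneg_left (hvar v) (sq_nonneg θ)) (by linarith)
  rw [h1] at hB
  have hev : ∀ (ω : Fin s → Fin n) (v : ι → ℝ), 2 * c ≤ v ⬝ᵥ (∑ i, θ • Z (ω i)) *ᵥ v
      ↔ s * ε ≤ v ⬝ᵥ (∑ i, Z (ω i)) *ᵥ v := fun ω v => by
    rw [← Finset.smul_sum, smul_mulVec, dotProduct_smul, smul_eq_mul, ← h2,
      mul_le_mul_iff_right₀ hθ0]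
  simp only [hev] at hB
  set P := probOf p (fun ω : Fin s → Fin n => ∃ v, v ⬝ᵥ v = 1
    ∧ s * ε ≤ v ⬝ᵥ (∑ i, Z (ω i)) *ᵥ v) with hP
  have hP0 : 0 ≤ P := by
    classical
    exact Finset.sum_nonneg fun ω _ => by
      split_ifs
      · exact Finset.prod_nonneg fun i _ => hp (ω i)
      · exact le_rfl
  have he2 : Real.exp (2 * c) = Real.exp c ^ 2 := by rw [← Real.exp_nat_mul]; norm_num
  have hec := Real.add_one_le_exp c
  set e := Real.exp c with he
  rw [he2] at hB
  have hpos : 0 < e ^ 2 - 2 * c - 1 := by nlinarith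
  have hkey : (e - 1) * e ≤ 2 * (e ^ 2 - 2 * c - 1) := by nlinarith
  have hPe : P * e ≤ 2 * L := by
    refine le_of_mul_le_mul_right ?_ hpos
    have h5 := mul_le_mul_of_nonneg_right hDL (by nlinarith : 0 ≤ (e - 1) * e)
    have h6 := mul_le_mul_of_nonneg_left hkey hL.le
    have h7 := mul_le_mul_of_nonneg_right hB (by linarith : 0 ≤ e)
    nlinarith
  rw [le_div_iff₀ (by linarith)]
  exact (mul_le_mul_of_nonneg_left hKc hP0).trans hPe

end Matrix

end Tail

section Sampling

lemma Matrix.IsHermitian.exists_le_abs_of_le_specNorm {r : ℕ} {S : Matrix (Fin r) (Fin r) ℝ}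
    (hS : S.IsHermitian) {ε : ℝ} (hε : 0 < ε) (h : ε ≤ specNorm S) :
    ∃ v, v ⬝ᵥ v = 1 ∧ ε ≤ |v ⬝ᵥ S *ᵥ v| := by
  open scoped Matrix.Norms.L2Operator in
  have hnorm : specNorm S = ‖hS.eigenvalues‖ := by
    have h1 : specNorm S = ‖S‖ := rfl
    have h2 : S = (hS.eigenvectorUnitary : Matrix (Fin r) (Fin r) ℝ) * diagonal hS.eigenvalues
        * ((star hS.eigenvectorUnitary : unitary _) : Matrix (Fin r) (Fin r) ℝ) :=
      hS.eq_eigMatrix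
    rw [h1]
    conv_lhs => rw [h2]
    rw [CStarRing.norm_mul_coe_unitary, CStarRing.norm_coe_unitary_mul, l2_opNorm_diagonal]
  rw [hnorm] at h
  obtain ⟨i, hi⟩ : ∃ i, ε ≤ |hS.eigenvalues i| := by
    by_contra! hlt
    exact h.not_gt ((pi_norm_lt_iff hε).2 hlt)
  exact ⟨hS.eigMatrix.col i, hS.col_dotProduct_col_self i, by
    rwa [← hS.eigenvalues_eq_dotProduct_col]⟩

variable {n r : ℕ} {X : Matrix (Fin n) (Fin r) ℝ} {D : Fin r → ℝ} {p : Fin n → ℝ}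

/-- The centred contribution of one sampled row of `X` to `Xᵀ Wᵀ W X`, before division by the
number of samples. -/
noncomputable def rowDeviation (X : Matrix (Fin n) (Fin r) ℝ) (D : Fin r → ℝ) (p : Fin n → ℝ)
    (x : Fin n) : Matrix (Fin r) (Fin r) ℝ :=
  (p x)⁻¹ • vecMulVec (X x) (X x) - diagonal D

lemma rowDeviation_isHermitian (x : Fin n) : (rowDeviation X D p x).IsHermitian := by
  ext i j
  simp only [rowDeviation, conjTranspose_apply, Matrix.sub_apply, Matrix.smul_apply,
    vecMulVec_apply, smul_eq_mul, star_trivial, diagonal_apply]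
  by_cases h : i = j
  · subst h; rfl
  · simp [h, Ne.symm h, mul_comm]

lemma dotProduct_diagonal_mulVec (v : Fin r → ℝ) :
    v ⬝ᵥ diagonal D *ᵥ v = ∑ i, D i * v i ^ 2 := by
  simp only [dotProduct, mulVec_diagonal]
  exact Finset.sum_congr rfl fun i _ => by ring

lemma samplingMatrix_gram_sub (hp : ∀ x, 0 ≤ p x) {s : ℕ} (hs : 0 < s) (ω : Fin s → Fin n) :
    (samplingMatrix p s ω * X)ᵀ * (samplingMatrix p s ω * X) - diagonal D
      = (s : ℝ)⁻¹ • ∑ i, rowDeviation X D p (ω i) := by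
  have hs' : (s : ℝ) ≠ 0 := by positivity
  have hrow : ∀ i a, (samplingMatrix p s ω * X) i a
      = (Real.sqrt (s * p (ω i)))⁻¹ * X (ω i) a := fun i a => by
    simp [mul_apply, samplingMatrix]
  ext a b
  have hsum : (∑ i, rowDeviation X D p (ω i)) a b
      = ∑ i, (p (ω i))⁻¹ * (X (ω i) a * X (ω i) b) - s * diagonal D a b := by
    simp [Matrix.sum_apply, rowDeviation, vecMulVec_apply, Finset.sum_sub_distrib]
  rw [Matrix.sub_apply, Matrix.smul_apply, hsum, smul_eq_mul, mul_sub, inv_mul_cancel_left₀ hs',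
    mul_apply, Finset.mul_sum]
  congr 1
  refine Finset.sum_congr rfl fun i _ => ?_
  rw [transpose_apply, hrow, hrow]
  have h2 : (Real.sqrt (s * p (ω i)))⁻¹ * (Real.sqrt (s * p (ω i)))⁻¹
      = (s : ℝ)⁻¹ * (p (ω i))⁻¹ := by
    rw [← mul_inv, Real.mul_self_sqrt (mul_nonneg (Nat.cast_nonneg s) (hp _)), mul_inv]
  linear_combination (X (ω i) a * X (ω i) b) * h2

lemma sum_vecMulVec_row (hX : Xᵀ * X = diagonal D) :
    ∑ x, vecMulVec (X x) (X x) = diagonal D := by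
  rw [← hX]
  ext a b
  simp [Matrix.sum_apply, vecMulVec_apply, mul_apply]

lemma sum_sum_sq_eq (hX : Xᵀ * X = diagonal D) : ∑ x, ∑ j, X x j ^ 2 = ∑ j, D j := by
  rw [Finset.sum_comm]
  refine Finset.sum_congr rfl fun j _ => ?_
  have h := congrFun (congrFun hX j) j
  rw [diagonal_apply_eq, mul_apply] at h
  rw [← h]
  exact Finset.sum_congr rfl fun x _ => by rw [transpose_apply, sq]

lemma diagonal_nonneg_of_gram (hX : Xᵀ * X = diagonal D) (j : Fin r) : 0 ≤ D j := by
  have h := congrFun (congrFun hX j) j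
  rw [diagonal_apply_eq, mul_apply] at h
  rw [← h]
  exact Finset.sum_nonneg fun x _ => mul_self_nonneg _

/-- Row sampling with probabilities proportional to squared row norms approximates a diagonal
Gram matrix in spectral norm. -/
theorem probOf_le_specNorm_gram_sub (hX : Xᵀ * X = diagonal D) (hD0 : 0 < ∑ j, D j)
    (hD1 : ∀ j, D j ≤ 1) {L : ℝ} (hL : 1 ≤ L) (hDL : ∑ j, D j ≤ L)
    (hp : ∀ x, p x = (∑ j, X x j ^ 2) / ∑ j, D j) {ε K : ℝ} (hε : 0 < ε) (hK : 3 ≤ K)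
    {s : ℕ} (hs0 : 0 < s) (hs : (1 + ε / 3) * (2 * L * Real.log K) / ε ^ 2 ≤ s) :
    probOf p (fun ω : Fin s → Fin n => ε ≤ specNorm
      ((samplingMatrix p s ω * X)ᵀ * (samplingMatrix p s ω * X) - diagonal D))
      ≤ 2 * (2 * L / K) := by
  have hDnn := diagonal_nonneg_of_gram hX
  set t := ∑ j, D j with ht
  have hp0 : ∀ x, 0 ≤ p x := fun x => by
    rw [hp]; exact div_nonneg (Finset.sum_nonneg fun j _ => sq_nonneg _) hD0.le
  have hp1 : ∑ x, p x = 1 := by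
    simp only [hp]
    rw [← Finset.sum_div, sum_sum_sq_eq hX, div_self hD0.ne']
  have hrow : ∀ x, X x ⬝ᵥ X x = t * p x := fun x => by
    rw [hp, mul_div_cancel₀ _ hD0.ne', dotProduct]
    exact Finset.sum_congr rfl fun j _ => (sq _).symm
  have hrow0 : ∀ x, p x = 0 → X x = 0 := fun x hx => by
    have h := hrow x
    rwa [hx, mul_zero, dotProduct_self_eq_zero] at h
  have hpY : ∀ x, p x • ((p x)⁻¹ • vecMulVec (X x) (X x)) = vecMulVec (X x) (X x) := fun x => by
    by_cases hx : p x = 0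
    · simp [hrow0 x hx]
    · rw [smul_smul, mul_inv_cancel₀ hx, one_smul]
  set Z := rowDeviation X D p with hZdef
  have hZH : ∀ x, (Z x).IsHermitian := rowDeviation_isHermitian
  have hmean : ∑ x, p x • Z x = 0 := by
    simp only [hZdef, rowDeviation, smul_sub, Finset.sum_sub_distrib, hpY]
    rw [sum_vecMulVec_row hX, ← Finset.sum_smul, hp1, one_smul, sub_self]
  have hquad : ∀ x v, v ⬝ᵥ Z x *ᵥ v
      = (p x)⁻¹ * (X x ⬝ᵥ v) ^ 2 - ∑ i, D i * v i ^ 2 := fun x v => by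
    rw [hZdef, rowDeviation, sub_mulVec, dotProduct_sub, dotProduct_diagonal_mulVec, smul_mulVec,
      dotProduct_smul, vecMulVec_mulVec, smul_eq_mul]
    congr 2
    simp [dotProduct_comm v, sq]
  have hZL : ∀ x v, |v ⬝ᵥ Z x *ᵥ v| ≤ L * (v ⬝ᵥ v) := fun x v => by
    have hvv : 0 ≤ v ⬝ᵥ v := Finset.sum_nonneg fun i _ => mul_self_nonneg (v i)
    have hDv0 : 0 ≤ ∑ i, D i * v i ^ 2 :=
      Finset.sum_nonneg fun i _ => mul_nonneg (hDnn i) (sq_nonneg _)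
    have hDv : ∑ i, D i * v i ^ 2 ≤ v ⬝ᵥ v := by
      rw [dotProduct]
      exact Finset.sum_le_sum fun i _ => by nlinarith [hD1 i, sq_nonneg (v i)]
    have hcs : (X x ⬝ᵥ v) ^ 2 ≤ (X x ⬝ᵥ X x) * (v ⬝ᵥ v) := by
      simpa only [dotProduct, ← sq] using Finset.sum_mul_sq_le_sq_mul_sq Finset.univ (X x) v
    have hY0 : 0 ≤ (p x)⁻¹ * (X x ⬝ᵥ v) ^ 2 :=
      mul_nonneg (inv_nonneg.2 (hp0 x)) (sq_nonneg _)
    have hY : (p x)⁻¹ * (X x ⬝ᵥ v) ^ 2 ≤ t * (v ⬝ᵥ v) := by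
      by_cases hx : p x = 0
      · rw [hx, _root_.inv_zero, zero_mul]; exact mul_nonneg hD0.le hvv
      · rw [inv_mul_le_iff₀ (lt_of_le_of_ne (hp0 x) (Ne.symm hx))]
        rw [hrow] at hcs
        linarith
    rw [hquad, abs_le]
    constructor <;> nlinarith
  have hvar : ∀ v, v ⬝ᵥ (∑ x, p x • (Z x * Z x)) *ᵥ v ≤ L * ∑ i, D i * v i ^ 2 := fun v => by
    have hYY : ∀ x, p x • ((p x)⁻¹ • vecMulVec (X x) (X x) * (p x)⁻¹ • vecMulVec (X x) (X x))
        = t • vecMulVec (X x) (X x) := fun x => by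
      rw [← Matrix.smul_mul, hpY, Matrix.mul_smul, vecMulVec_mul_vecMulVec, hrow]
      by_cases hx : p x = 0
      · simp [hrow0 x hx]
      · ext a b
        simp only [Matrix.smul_apply, vecMulVec_apply, smul_eq_mul, Pi.smul_apply]
        field_simp
    have hsum : ∑ x, p x • (Z x * Z x) = t • diagonal D - diagonal D * diagonal D := by
      have : ∀ x, p x • (Z x * Z x) = t • vecMulVec (X x) (X x)
          - vecMulVec (X x) (X x) * diagonal D - diagonal D * vecMulVec (X x) (X x)
          + p x • (diagonal D * diagonal D) := fun x => by
        rw [hZdef, rowDeviation, sub_mul, mul_sub, mul_sub, smul_sub, smul_sub, smul_sub, hYY,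
          ← Matrix.smul_mul, ← Matrix.mul_smul (diagonal D), hpY]
        abel
      simp only [this, Finset.sum_add_distrib, Finset.sum_sub_distrib, ← Finset.smul_sum,
        ← Finset.sum_smul, ← Finset.sum_mul, ← Finset.mul_sum, sum_vecMulVec_row hX, hp1,
        one_smul]
      abel
    rw [hsum, sub_mulVec, dotProduct_sub, smul_mulVec, dotProduct_smul, smul_eq_mul,
      diagonal_mul_diagonal, dotProduct_diagonal_mulVec, dotProduct_diagonal_mulVec]
    have h1 : 0 ≤ ∑ i, D i * D i * v i ^ 2 :=
      Finset.sum_nonneg fun i _ => mul_nonneg (mul_self_nonneg _) (sq_nonneg _)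
    have h2 : 0 ≤ ∑ i, D i * v i ^ 2 :=
      Finset.sum_nonneg fun i _ => mul_nonneg (hDnn i) (sq_nonneg _)
    nlinarith
  have hsR : (0 : ℝ) < s := by exact_mod_cast hs0
  have hupper := probOf_le_of_sample_size (s := s) hp0 hp1 hZH hmean (by linarith) hZL hDnn hD1 hDL
    hvar hε hK hs
  have hlower := probOf_le_of_sample_size (s := s) (Z := fun x => -Z x) hp0 hp1
    (fun x => (hZH x).neg)
    (by simp only [smul_neg, Finset.sum_neg_distrib, hmean, neg_zero]) (by linarith)
    (fun x v => by rw [neg_mulVec, dotProduct_neg, abs_neg]; exact hZL x v) hDnn hD1 hDL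
    (fun v => by simpa only [neg_mul_neg] using hvar v) hε hK hs
  rw [two_mul]
  refine (probOf_le_add hp0 fun ω hω => ?_).trans (add_le_add hupper hlower)
  rw [samplingMatrix_gram_sub hp0 hs0 ω] at hω
  have hH : (∑ i, Z (ω i)).IsHermitian := isHermitian_sum_finset fun i => hZH (ω i)
  obtain ⟨v, hv1, hv⟩ := IsHermitian.exists_le_abs_of_le_specNorm
    (S := (s : ℝ)⁻¹ • ∑ i, Z (ω i))
    (by rw [IsHermitian, conjTranspose_smul, hH, star_trivial]) hε hω
  rw [smul_mulVec, dotProduct_smul, smul_eq_mul, abs_mul, abs_of_pos (inv_pos.2 hsR),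
    le_inv_mul_iff₀ hsR] at hv
  rcases le_abs.1 hv with h | h
  · exact Or.inl ⟨v, hv1, h⟩
  · exact Or.inr ⟨v, hv1, by
      simpa only [Finset.sum_neg_distrib, neg_mulVec, dotProduct_neg] using h⟩

end Sampling

section Ridge

variable {r : ℕ} {σ : Fin r → ℝ} {lam : ℝ}

lemma frobNorm_sub_truncDiag_sq {n d : ℕ} {U : Matrix (Fin n) (Fin r) ℝ}
    {V : Matrix (Fin d) (Fin r) ℝ} (hU : Uᵀ * U = 1) (hV : Vᵀ * V = 1) {k : ℕ} :
    frobNorm (U * diagonal σ * Vᵀ - U * truncDiag σ k * Vᵀ) ^ 2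
      = ∑ i : Fin r, if (i : ℕ) < k then 0 else σ i ^ 2 := by
  set b : Fin r → ℝ := fun i => if (i : ℕ) < k then 0 else σ i with hb
  have hsub : U * diagonal σ * Vᵀ - U * truncDiag σ k * Vᵀ = U * diagonal b * Vᵀ := by
    rw [← Matrix.sub_mul, ← Matrix.mul_sub, truncDiag, diagonal_sub]
    congr 3
    ext i
    simp only [hb]
    split_ifs <;> simp
  have htrace : ∀ M : Matrix (Fin n) (Fin d) ℝ, ∑ i, ∑ j, M i j ^ 2 = trace (M * Mᵀ) :=
    fun M => by simp only [trace, diag_apply, mul_apply, transpose_apply, sq]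
  rw [hsub, frobNorm, Real.sq_sqrt (by positivity), htrace]
  simp only [transpose_mul, transpose_transpose, diagonal_transpose, Matrix.mul_assoc]
  rw [← Matrix.mul_assoc Vᵀ, hV, Matrix.one_mul, trace_mul_comm]
  simp only [Matrix.mul_assoc]
  rw [hU, Matrix.mul_one, diagonal_mul_diagonal, trace_diagonal]
  refine Finset.sum_congr rfl fun i _ => ?_
  simp only [hb]
  split_ifs <;> ring

lemma ridgeDiag_mul_self (hlam : 0 ≤ lam) :
    ridgeDiag σ lam * ridgeDiag σ lam = diagonal fun i => σ i ^ 2 / (σ i ^ 2 + lam) := by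
  rw [ridgeDiag, diagonal_mul_diagonal]
  congr 1
  ext i
  rw [div_mul_div_comm, Real.mul_self_sqrt (by positivity), sq]

/-- The effective dimension at ridge parameter `lam` is at most `2 * k`. -/
lemma sum_ridge_le (hlam : 0 < lam) {k : ℕ} (hk : k ≤ r)
    (h : k * lam = ∑ i : Fin r, if (i : ℕ) < k then 0 else σ i ^ 2) :
    ∑ i, σ i ^ 2 / (σ i ^ 2 + lam) ≤ 2 * k := by
  have hcard : ∑ i : Fin r, (if (i : ℕ) < k then (1 : ℝ) else 0) = k := by
    rw [Fin.sum_univ_eq_sum_range (fun i => if i < k then (1 : ℝ) else 0) r,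
      ← Finset.sum_filter]
    have : (Finset.range r).filter (fun i => i < k) = Finset.range k := by
      ext i
      simp only [Finset.mem_filter, Finset.mem_range]
      omega
    simp [this]
  have hterm : ∀ i : Fin r, σ i ^ 2 / (σ i ^ 2 + lam) ≤ (if (i : ℕ) < k then (1 : ℝ) else 0)
      + (if (i : ℕ) < k then 0 else σ i ^ 2) / lam := fun i => by
    split_ifs
    · rw [zero_div, add_zero, div_le_one (by positivity)]
      linarith
    · rw [zero_add]
      exact div_le_div_of_nonneg_left (sq_nonneg _) hlam (by linarith [sq_nonneg (σ i)])
  refine (Finset.sum_le_sum fun i _ => hterm i).trans ?_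
  rw [Finset.sum_add_distrib, hcard, ← Finset.sum_div, ← h, mul_div_cancel_right₀ _ hlam.ne',
    two_mul]

end Ridge

/-- ridge leverage score sampling satisfies the first structural condition. -/
theorem stmt_16 {n d r : ℕ} {k : ℕ} (s : ℕ) (hs : 0 < s)
    (A : Matrix (Fin n) (Fin d) ℝ)
    (U : Matrix (Fin n) (Fin r) ℝ) (V : Matrix (Fin d) (Fin r) ℝ) (σ : Fin r → ℝ)
    (hU : Uᵀ * U = 1) (hV : Vᵀ * V = 1)
    (hσdec : ∀ i j : Fin r, i ≤ j → σ j ≤ σ i) (hσpos : ∀ i, 0 < σ i)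
    (hA : A = U * Matrix.diagonal σ * Vᵀ) (hrank : A.rank = r)
    (hk1 : 1 ≤ k) (hkr : k < r)
    (lam : ℝ) (hlam : lam = frobNorm (A - U * truncDiag σ k * Vᵀ) ^ 2 / k)
    (p : Fin n → ℝ)
    (hpdef : ∀ i, p i = (∑ j, ((U * ridgeDiag σ lam) i j) ^ 2)
        / (∑ i', ∑ j, ((U * ridgeDiag σ lam) i' j) ^ 2))
    (ε δ : ℝ) (hε0 : 0 < ε) (hε1 : ε < 1) (hδ0 : 0 < δ) (hδ1 : δ < 1)
    (hsbig : (s : ℝ) ≥ (1 + ε / 3) * (4 * k * Real.log (16 * (1 + 2 * k) / δ)) / ε ^ 2) :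
    probOf p (fun (ω : Fin s → Fin n) =>
      ε ≤ specNorm (ridgeDiag σ lam * Uᵀ * (samplingMatrix p s ω)ᵀ
        * samplingMatrix p s ω * U * ridgeDiag σ lam - ridgeDiag σ lam * ridgeDiag σ lam))
    ≤ δ / 4 := by
  have hk0 : (0 : ℝ) < k := by exact_mod_cast hk1
  have hlam' : k * lam = ∑ i : Fin r, if (i : ℕ) < k then 0 else σ i ^ 2 := by
    rw [hlam, mul_div_cancel₀ _ hk0.ne', hA, frobNorm_sub_truncDiag_sq hU hV]
  have hlam0 : 0 < lam := by
    refine (pos_iff_pos_of_mul_pos (a := (k : ℝ)) ?_).1 hk0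
    rw [hlam']
    refine Finset.sum_pos' (fun i _ => ?_) ⟨⟨k, hkr⟩, Finset.mem_univ _, ?_⟩
    · split_ifs
      exacts [le_rfl, sq_nonneg _]
    · rw [if_neg (lt_irrefl k)]
      exact pow_pos (hσpos _) 2
  set D : Fin r → ℝ := fun i => σ i ^ 2 / (σ i ^ 2 + lam) with hD
  have hRR : ridgeDiag σ lam * ridgeDiag σ lam = diagonal D := ridgeDiag_mul_self hlam0.le
  have hRT : (ridgeDiag σ lam)ᵀ = ridgeDiag σ lam := diagonal_transpose _
  have hX : (U * ridgeDiag σ lam)ᵀ * (U * ridgeDiag σ lam) = diagonal D := by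
    rw [transpose_mul, hRT, Matrix.mul_assoc, ← Matrix.mul_assoc Uᵀ, hU, Matrix.one_mul, hRR]
  have hDpos : ∀ i, 0 < D i := fun i => by
    have := hσpos i
    positivity
  have hD1 : ∀ i, D i ≤ 1 := fun i => by
    rw [div_le_one (by have := hσpos i; positivity)]
    linarith
  have hDL : ∑ i, D i ≤ 2 * k := sum_ridge_le hlam0 hkr.le hlam'
  have h16 : 16 * (1 + 2 * (k : ℝ)) ≤ 16 * (1 + 2 * k) / δ :=
    le_div_self (by positivity) hδ0 hδ1.le
  have hk1' : (1 : ℝ) ≤ k := by exact_mod_cast hk1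
  have hmain := probOf_le_specNorm_gram_sub (s := s) (p := p) hX
    (Finset.sum_pos (fun i _ => hDpos i) ⟨⟨k, hkr⟩, Finset.mem_univ _⟩) hD1
    (by linarith : (1 : ℝ) ≤ 2 * k) hDL
    (fun x => by rw [hpdef, sum_sum_sq_eq hX]) hε0 (by linarith) hs
    (le_of_eq_of_le (by ring) hsbig)
  have hgram : ∀ ω, ridgeDiag σ lam * Uᵀ * (samplingMatrix p s ω)ᵀ
      * samplingMatrix p s ω * U * ridgeDiag σ lam - ridgeDiag σ lam * ridgeDiag σ lam
      = (samplingMatrix p s ω * (U * ridgeDiag σ lam))ᵀ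
        * (samplingMatrix p s ω * (U * ridgeDiag σ lam)) - diagonal D := fun ω => by
    simp only [hRR, transpose_mul, hRT, Matrix.mul_assoc]
  simp only [hgram]
  refine hmain.trans ?_
  rw [div_div_eq_mul_div, ← mul_div_assoc, div_le_div_iff₀ (by positivity) (by norm_num)]
  nlinarith
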